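/- Let (X,d) be a compact metric space, f : X → X continuous, ψ ∈ C(X,ℝ) with ψ > 0, Φ ∈ C(X,ℝ)^d, and F : ℝ^d → ℝ continuous. For T > 0 let G_T = {n ∈ ℕ : S_nψ(x) > T for some x ∈ X} and Y_n = {x ∈ X : S_nψ(x) > T} for n ∈ G_T; for φ ∈ C(X,ℝ) and ε > 0 let R^F_{ψ,T}(Φ,φ,ε) = sup{Σ_{n∈G_T} Σ_{x∈E'_n} exp(n F(S_nΦ(x)/n) + S_nφ(x)) : E'_n an (n,ε)-separated set of Y_n for each n ∈ G_T}. Then P^F_ψ(Φ) = inf{β ∈ ℝ : lim_{ε→0} limsup_{T→∞} R^F_{ψ,T}(Φ, −βψ, ε) < ∞}, with the convention inf ∅ = +∞. -/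

import Mathlib

open Filter Set Topology MeasureTheory ENNReal

variable {X : Type*}

/-- Birkhoff sum `S_n φ = ∑_{i<n} φ ∘ f^i`. -/
def birkhoff (f : X → X) (φ : X → ℝ) (n : ℕ) (x : X) : ℝ :=
  ∑ i ∈ Finset.range n, φ (f^[i] x)

section Metric
variable [MetricSpace X]

/-- `F` is an `(n,ε)`-spanning set of `Z`: every `y ∈ Z` is within Bowen distance
`d_n ≤ ε` of some point of `F`. -/
def IsSpanningSetOf (f : X → X) (n : ℕ) (ε : ℝ) (Z : Set X) (F : Finset X) : Prop :=
  ∀ y ∈ Z, ∃ x ∈ F, ∀ i < n, dist (f^[i] x) (f^[i] y) ≤ ε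

/-- `E` is an `(n,ε)`-separated set of `Z`: `E ⊆ Z` and distinct points of `E` are at
Bowen distance `d_n > ε`. -/
def IsSeparatedSetOf (f : X → X) (n : ℕ) (ε : ℝ) (Z : Set X) (E : Finset X) : Prop :=
  (E : Set X) ⊆ Z ∧ ∀ x ∈ E, ∀ y ∈ E, x ≠ y → ∃ i < n, ε < dist (f^[i] x) (f^[i] y)

/-- `S_T = {n : ℕ | ∃ x, S_nψ(x) ≤ T < S_{n+1}ψ(x)}`. -/
def inducedST (f : X → X) (ψ : X → ℝ) (T : ℝ) : Set ℕ :=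
  {n | ∃ x : X, birkhoff f ψ n x ≤ T ∧ T < birkhoff f ψ (n + 1) x}

/-- `X_n = {x | S_nψ(x) ≤ T < S_{n+1}ψ(x)}`. -/
def inducedXn (f : X → X) (ψ : X → ℝ) (T : ℝ) (n : ℕ) : Set X :=
  {x | birkhoff f ψ n x ≤ T ∧ T < birkhoff f ψ (n + 1) x}

/-- `Q_{ψ,T}(f,φ,ε)`: infimum over families of `(n,ε)`-spanning sets of the `X_n`, `n ∈ S_T`,
of `∑_{n ∈ S_T} ∑_{x ∈ F_n} e^{S_nφ(x)}`. -/
noncomputable def inducedQ (f : X → X) (ψ φ : X → ℝ) (T ε : ℝ) : ℝ≥0∞ :=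
  ⨅ (F : ℕ → Finset X) (_ : ∀ n ∈ inducedST f ψ T,
      IsSpanningSetOf f n ε (inducedXn f ψ T n) (F n)),
    ∑' n : inducedST f ψ T, ∑ x ∈ F n, ENNReal.ofReal (Real.exp (birkhoff f φ n x))

/-- `P_{ψ,T}(f,φ,ε)`: supremum over families of `(n,ε)`-separated sets of the `X_n`, `n ∈ S_T`,
of `∑_{n ∈ S_T} ∑_{x ∈ E_n} e^{S_nφ(x)}`. -/
noncomputable def inducedPsep (f : X → X) (ψ φ : X → ℝ) (T ε : ℝ) : ℝ≥0∞ :=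
  ⨆ (E : ℕ → Finset X) (_ : ∀ n ∈ inducedST f ψ T,
      IsSeparatedSetOf f n ε (inducedXn f ψ T n) (E n)),
    ∑' n : inducedST f ψ T, ∑ x ∈ E n, ENNReal.ofReal (Real.exp (birkhoff f φ n x))

/-- The ψ-induced topological pressure
`P_ψ(φ) = lim_{ε→0⁺} limsup_{T→∞} (1/T) log Q_{ψ,T}(f,φ,ε)`, the limit as `ε → 0⁺`
being realized as a `limsup` along `𝓝[>] 0` (since `ε ↦ limsup_T …` is monotone,
this coincides with the limit). -/
noncomputable def inducedPressure (f : X → X) (ψ φ : X → ℝ) : EReal :=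
  limsup (fun ε : ℝ =>
    limsup (fun T : ℝ => ENNReal.log (inducedQ f ψ φ T ε) * ((T⁻¹ : ℝ) : EReal)) atTop)
    (𝓝[>] (0 : ℝ))

/-- Topological entropy `h_top(f) = P_ψ(0)` with `ψ ≡ 1`. -/
noncomputable def topEntropy (f : X → X) : EReal :=
  inducedPressure f (fun _ => 1) (fun _ => 0)

end Metric
section NL
variable [MetricSpace X]

/-- The `d`-dimensional Birkhoff sum `S_nΦ` of `Φ ∈ C(X,ℝ)^d`. -/
def birkhoffVec (f : X → X) {d : ℕ} (Φ : X → Fin d → ℝ) (n : ℕ) (x : X) : Fin d → ℝ :=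
  fun i => birkhoff f (fun y => Φ y i) n x

/-- The nonlinear weight `exp(n F(S_nΦ(x)/n))`. -/
noncomputable def nlWeight (f : X → X) {d : ℕ} (F : (Fin d → ℝ) → ℝ) (Φ : X → Fin d → ℝ)
    (n : ℕ) (x : X) : ℝ≥0∞ :=
  ENNReal.ofReal (Real.exp (n * F (fun i => birkhoffVec f Φ n x i / n)))

/-- `Q^F_{ψ,T}(f,Φ,ε)`: infimum over families of `(n,ε)`-spanning sets of the `X_n`,
`n ∈ S_T`, of `∑_{n ∈ S_T} ∑_{x ∈ F_n} exp(n F(S_nΦ(x)/n))`. -/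
noncomputable def nlInducedQ (f : X → X) {d : ℕ} (ψ : X → ℝ) (F : (Fin d → ℝ) → ℝ)
    (Φ : X → Fin d → ℝ) (T ε : ℝ) : ℝ≥0∞ :=
  ⨅ (C : ℕ → Finset X) (_ : ∀ n ∈ inducedST f ψ T,
      IsSpanningSetOf f n ε (inducedXn f ψ T n) (C n)),
    ∑' n : inducedST f ψ T, ∑ x ∈ C n, nlWeight f F Φ n x

/-- The nonlinear ψ-induced topological pressure
`P^F_ψ(Φ) = lim_{ε→0⁺} limsup_{T→∞} (1/T) log Q^F_{ψ,T}(f,Φ,ε)` (limit as `ε → 0⁺`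
realized as a `limsup` along `𝓝[>] 0`). -/
noncomputable def nlInducedPressure (f : X → X) {d : ℕ} (ψ : X → ℝ) (F : (Fin d → ℝ) → ℝ)
    (Φ : X → Fin d → ℝ) : EReal :=
  limsup (fun ε : ℝ =>
    limsup (fun T : ℝ => ENNReal.log (nlInducedQ f ψ F Φ T ε) * ((T⁻¹ : ℝ) : EReal)) atTop)
    (𝓝[>] (0 : ℝ))

end NL

section Stmt18
variable [MetricSpace X]

/-- `G_T = {n : ℕ | ∃ x, S_nψ(x) > T}`. -/
def inducedGT (f : X → X) (ψ : X → ℝ) (T : ℝ) : Set ℕ :=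
  {n | ∃ x : X, T < birkhoff f ψ n x}

/-- `Y_n = {x | S_nψ(x) > T}`. -/
def inducedYn (f : X → X) (ψ : X → ℝ) (T : ℝ) (n : ℕ) : Set X :=
  {x | T < birkhoff f ψ n x}

/-- `R^F_{ψ,T}(Φ,φ,ε)`: supremum over families of `(n,ε)`-separated sets of the `Y_n`,
`n ∈ G_T`, of `∑_{n ∈ G_T} ∑_{x ∈ E'_n} exp(n F(S_nΦ(x)/n) + S_nφ(x))`. -/
noncomputable def nlR (f : X → X) {d : ℕ} (ψ : X → ℝ) (F : (Fin d → ℝ) → ℝ)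
    (Φ : X → Fin d → ℝ) (φ : X → ℝ) (T ε : ℝ) : ℝ≥0∞ :=
  ⨆ (E : ℕ → Finset X) (_ : ∀ n ∈ inducedGT f ψ T,
      IsSeparatedSetOf f n ε (inducedYn f ψ T n) (E n)),
    ∑' n : inducedGT f ψ T, ∑ x ∈ E n,
      nlWeight f F Φ n x * ENNReal.ofReal (Real.exp (birkhoff f φ n x))

end Stmt18

section BirkhoffSums

lemma birkhoff_succ (f : X → X) (φ : X → ℝ) (n : ℕ) (x : X) :
    birkhoff f φ (n + 1) x = birkhoff f φ n x + φ (f^[n] x) :=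
  Finset.sum_range_succ _ _

lemma birkhoff_const_mul (f : X → X) (φ : X → ℝ) (c : ℝ) (n : ℕ) (x : X) :
    birkhoff f (fun y => c * φ y) n x = c * birkhoff f φ n x :=
  (Finset.mul_sum _ _ _).symm

lemma mul_le_birkhoff (f : X → X) {ψ : X → ℝ} {m : ℝ} (hm : ∀ x, m ≤ ψ x) (n : ℕ) (x : X) :
    n * m ≤ birkhoff f ψ n x := by
  simpa [birkhoff] using
    Finset.card_nsmul_le_sum (Finset.range n) (fun i => ψ (f^[i] x)) m (fun i _ => hm _)

/-- Averages of functions that are `η`-close along two orbit segments are `η`-close. -/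
lemma abs_birkhoff_div_sub_le (f : X → X) {φ : X → ℝ} {η : ℝ} (hη : 0 ≤ η) {n : ℕ} {x y : X}
    (h : ∀ i < n, |φ (f^[i] x) - φ (f^[i] y)| ≤ η) :
    |birkhoff f φ n x / n - birkhoff f φ n y / n| ≤ η := by
  rw [← sub_div, abs_div, Nat.abs_cast]
  refine div_le_of_le_mul₀ n.cast_nonneg hη ?_
  rw [birkhoff, birkhoff, ← Finset.sum_sub_distrib]
  refine (Finset.abs_sum_le_sum_abs _ _).trans ?_
  refine (Finset.sum_le_card_nsmul _ _ η fun i hi => h i (Finset.mem_range.1 hi)).trans ?_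
  simp [mul_comm]

lemma abs_birkhoff_div_le (f : X → X) {φ : X → ℝ} {K : ℝ} (hK : 0 ≤ K)
    (h : ∀ x, |φ x| ≤ K) (n : ℕ) (x : X) : |birkhoff f φ n x / n| ≤ K := by
  rw [abs_div, Nat.abs_cast]
  refine div_le_of_le_mul₀ n.cast_nonneg hK ?_
  refine (Finset.abs_sum_le_sum_abs _ _).trans ?_
  refine (Finset.sum_le_card_nsmul _ _ K fun i _ => h _).trans ?_
  simp [mul_comm]

lemma exists_pos_bounds [MetricSpace X] [CompactSpace X] {ψ : X → ℝ} (hψ : Continuous ψ)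
    (hψpos : ∀ x, 0 < ψ x) : ∃ m M : ℝ, 0 < m ∧ (∀ x, m ≤ ψ x) ∧ ∀ x, ψ x ≤ M := by
  cases isEmpty_or_nonempty X
  · exact ⟨1, 1, one_pos, isEmptyElim, isEmptyElim⟩
  · obtain ⟨a, -, ha⟩ := isCompact_univ.exists_isMinOn univ_nonempty hψ.continuousOn
    obtain ⟨b, -, hb⟩ := isCompact_univ.exists_isMaxOn univ_nonempty hψ.continuousOn
    exact ⟨ψ a, ψ b, hψpos a, fun x => ha (mem_univ x), fun x => hb (mem_univ x)⟩

lemma abs_birkhoff_sub_le_of_mem_inducedXn [MetricSpace X] {f : X → X} {ψ : X → ℝ} {M T : ℝ}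
    (hM : ∀ x, ψ x ≤ M) {n : ℕ} {x : X} (hx : x ∈ inducedXn f ψ T n) :
    |birkhoff f ψ n x - T| ≤ M := by
  have h := hx.2
  rw [birkhoff_succ] at h
  rw [abs_sub_comm, abs_of_nonneg (sub_nonneg.2 hx.1)]
  linarith [hM (f^[n] x)]

/-- The interval `[S_nψ(x), S_{n+1}ψ(x))` has length at least `m`, so it meets the grid
`T + ℕ m` as soon as `S_nψ(x) > T`. -/
lemma exists_mem_inducedXn_add_mul [MetricSpace X] {f : X → X} {ψ : X → ℝ} {m T : ℝ}
    (hm0 : 0 < m) (hm : ∀ x, m ≤ ψ x) {n : ℕ} {x : X} (hx : x ∈ inducedYn f ψ T n) :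
    ∃ k : ℕ, x ∈ inducedXn f ψ (T + k * m) n := by
  have hx' : T < birkhoff f ψ n x := hx
  refine ⟨⌈(birkhoff f ψ n x - T) / m⌉₊, ?_, ?_⟩
  · have := (div_le_iff₀ hm0).1 (Nat.le_ceil ((birkhoff f ψ n x - T) / m))
    linarith
  · have h := Nat.ceil_lt_add_one (div_nonneg (sub_nonneg.2 hx'.le) hm0.le)
    rw [← sub_lt_iff_lt_add, lt_div_iff₀ hm0] at h
    rw [birkhoff_succ]
    linarith [hm (f^[n] x)]

end BirkhoffSums

section SeparatedSets
variable [MetricSpace X]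

lemma IsSeparatedSetOf.mono {f : X → X} {n : ℕ} {ε : ℝ} {Z Z' : Set X} {E E' : Finset X}
    (h : IsSeparatedSetOf f n ε Z E) (hE : E' ⊆ E) (hZ : (E' : Set X) ⊆ Z') :
    IsSeparatedSetOf f n ε Z' E' :=
  ⟨hZ, fun x hx y hy => h.2 x (hE hx) y (hE hy)⟩

/-- An `(n,ε)`-separated set injects into any `(n,ε/2)`-spanning set, moving points by at most
`ε/2` in the Bowen distance. -/
lemma IsSeparatedSetOf.exists_injOn {f : X → X} {n : ℕ} {ε : ℝ} {Z : Set X} {E C : Finset X}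
    (hE : IsSeparatedSetOf f n ε Z E) (hC : IsSpanningSetOf f n (ε / 2) Z C) :
    ∃ g : X → X, (∀ x ∈ E, g x ∈ C ∧ ∀ i < n, dist (f^[i] (g x)) (f^[i] x) ≤ ε / 2) ∧
      Set.InjOn g E := by
  choose! g hg using hC
  refine ⟨g, fun x hx => hg x (hE.1 hx), fun x hx y hy hxy => ?_⟩
  by_contra hne
  obtain ⟨i, hi, hlt⟩ := hE.2 x hx y hy hne
  have h1 := (hg x (hE.1 hx)).2 i hi
  have h2 := (hg y (hE.1 hy)).2 i hi
  rw [← hxy] at h2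
  linarith [dist_triangle_left (f^[i] x) (f^[i] y) (f^[i] (g x))]

lemma exists_isSpanningSetOf_univ [CompactSpace X] {f : X → X} (hf : Continuous f) (n : ℕ)
    {ε : ℝ} (hε : 0 < ε) : ∃ C : Finset X, IsSpanningSetOf f n ε univ C := by
  let U : X → Set X := fun x => {y | ∀ i < n, dist (f^[i] x) (f^[i] y) < ε}
  have hU : ∀ x ∈ (univ : Set X), U x ∈ 𝓝 x := fun x _ => by
    have : ∀ᶠ y in 𝓝 x, ∀ i ∈ Set.Iio n, dist (f^[i] x) (f^[i] y) < ε :=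
      (eventually_all_finite (Set.finite_Iio n)).2 fun i _ =>
        ((continuous_const.dist (hf.iterate i)).tendsto x).eventually_lt_const (by simpa using hε)
    exact this
  obtain ⟨C, -, hC⟩ := isCompact_univ.elim_nhds_subcover U hU
  refine ⟨C, fun y hy => ?_⟩
  obtain ⟨x, hx, hxy⟩ := mem_iUnion₂.1 (hC hy)
  exact ⟨x, hx, fun i hi => (hxy i hi).le⟩

/-- A separated set of maximal cardinality is spanning. -/
lemma exists_isSeparatedSetOf_isSpanningSetOf [CompactSpace X] {f : X → X} (hf : Continuous f)
    (n : ℕ) {ε : ℝ} (hε : 0 < ε) (Z : Set X) :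
    ∃ E : Finset X, IsSeparatedSetOf f n ε Z E ∧ IsSpanningSetOf f n ε Z E := by
  classical
  obtain ⟨C, hC⟩ := exists_isSpanningSetOf_univ hf n (half_pos hε)
  have hcard : ∀ E : Finset X, IsSeparatedSetOf f n ε Z E → E.card ≤ C.card := fun E hE => by
    obtain ⟨g, hg, hinj⟩ := hE.exists_injOn (fun y _ => hC y (mem_univ y))
    exact Finset.card_le_card_of_injOn g (fun x hx => (hg x hx).1) hinj
  let P : ℕ → Prop := fun k => ∃ E : Finset X, IsSeparatedSetOf f n ε Z E ∧ E.card = k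
  have hP : P 0 := ⟨∅, by simp [IsSeparatedSetOf], rfl⟩
  obtain ⟨E, hE, hEcard⟩ : P (Nat.findGreatest P C.card) :=
    Nat.findGreatest_spec (Nat.zero_le _) hP
  refine ⟨E, hE, fun y hy => ?_⟩
  by_contra! hfar
  have hyE : y ∉ E := fun h => by
    obtain ⟨i, -, hi⟩ := hfar y h
    rw [dist_self] at hi
    exact hε.not_gt hi
  have hsep : IsSeparatedSetOf f n ε Z (insert y E) := by
    refine ⟨by simpa [Set.insert_subset_iff] using ⟨hy, hE.1⟩, fun a ha b hb hab => ?_⟩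
    rcases Finset.mem_insert.1 ha with rfl | haE <;> rcases Finset.mem_insert.1 hb with rfl | hbE
    · exact absurd rfl hab
    · obtain ⟨i, hi, h⟩ := hfar b hbE
      exact ⟨i, hi, by rwa [dist_comm]⟩
    · exact hfar a haE
    · exact hE.2 a haE b hbE hab
  have := Nat.le_findGreatest (P := P) (hcard _ hsep) ⟨_, hsep, rfl⟩
  rw [Finset.card_insert_of_notMem hyE] at this
  omega

end SeparatedSets

section Weights
variable [MetricSpace X]

/-- Uniformly in `n`, the exponents `n F(S_nΦ/n)` at two points of small Bowen distance differ
by at most `n δ`. -/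
lemma eventually_forall_mul_birkhoffVec_le [CompactSpace X] {d : ℕ} (f : X → X)
    {Φ : X → Fin d → ℝ} (hΦ : Continuous Φ) {F : (Fin d → ℝ) → ℝ} (hF : Continuous F)
    {δ : ℝ} (hδ : 0 < δ) :
    ∀ᶠ ε in 𝓝[>] (0 : ℝ), ∀ (n : ℕ) (x y : X), (∀ i < n, dist (f^[i] x) (f^[i] y) ≤ ε) →
      n * F (fun i => birkhoffVec f Φ n y i / n) ≤
        n * δ + n * F (fun i => birkhoffVec f Φ n x i / n) := by
  obtain ⟨K, hK⟩ : ∃ K, ∀ x, ‖Φ x‖ ≤ K := by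
    obtain ⟨K, hK⟩ := (isCompact_range hΦ).isBounded.exists_norm_le
    exact ⟨K, fun x => hK _ (mem_range_self x)⟩
  have hFu := (isCompact_closedBall (0 : Fin d → ℝ) |K|).uniformContinuousOn_of_continuous
    hF.continuousOn
  obtain ⟨η, hη, hFη⟩ := Metric.uniformContinuousOn_iff_le.1 hFu δ hδ
  obtain ⟨ε₀, hε₀, hΦε⟩ := Metric.uniformContinuous_iff_le.1
    (CompactSpace.uniformContinuous_of_continuous hΦ) η hη
  filter_upwards [Ioc_mem_nhdsGT hε₀] with ε hε n x y hxy
  have hmem : ∀ z, (fun i => birkhoffVec f Φ n z i / n) ∈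
      Metric.closedBall (0 : Fin d → ℝ) |K| := fun z => by
    rw [mem_closedBall_zero_iff, pi_norm_le_iff_of_nonneg (abs_nonneg K)]
    exact fun i => abs_birkhoff_div_le f (abs_nonneg K)
      (fun w => ((norm_le_pi_norm (Φ w) i).trans (hK w)).trans (le_abs_self K)) n z
  have hdist : dist (fun i => birkhoffVec f Φ n y i / n)
      (fun i => birkhoffVec f Φ n x i / n) ≤ η := by
    refine (dist_pi_le_iff hη.le).2 fun i => ?_
    refine abs_birkhoff_div_sub_le f hη.le fun j hj => ?_
    rw [← Real.dist_eq]
    refine (dist_le_pi_dist (Φ (f^[j] y)) (Φ (f^[j] x)) i).trans (hΦε ?_)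
    rw [dist_comm]
    exact (hxy j hj).trans hε.2
  have h := le_of_abs_le (hFη _ (hmem y) _ (hmem x) hdist)
  rw [← mul_add]
  exact mul_le_mul_of_nonneg_left (by linarith) n.cast_nonneg

lemma nlInducedQ_le_mul_nlR [CompactSpace X] {d : ℕ} {f : X → X} (hf : Continuous f)
    {ψ : X → ℝ} {M : ℝ} (hM : ∀ x, ψ x ≤ M) (F : (Fin d → ℝ) → ℝ) (Φ : X → Fin d → ℝ)
    (β T : ℝ) {ε : ℝ} (hε : 0 < ε) :
    nlInducedQ f ψ F Φ T ε ≤ ENNReal.ofReal (Real.exp (β * T + |β| * M)) *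
      nlR f ψ F Φ (fun x => -β * ψ x) (T - M) ε := by
  choose E hsep hspan using
    fun n => exists_isSeparatedSetOf_isSpanningSetOf hf n hε (inducedXn f ψ T n)
  have hXY : ∀ n, inducedXn f ψ T n ⊆ inducedYn f ψ (T - M) n := fun n x hx => by
    have h := hx.2
    rw [birkhoff_succ] at h
    change T - M < birkhoff f ψ n x
    linarith [hM (f^[n] x)]
  have hST : inducedST f ψ T ⊆ inducedGT f ψ (T - M) := fun n ⟨x, hx⟩ => ⟨x, hXY n hx⟩
  have hR : ∑' n : inducedGT f ψ (T - M), ∑ x ∈ E n, nlWeight f F Φ n x *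
      ENNReal.ofReal (Real.exp (birkhoff f (fun x => -β * ψ x) n x)) ≤
      nlR f ψ F Φ (fun x => -β * ψ x) (T - M) ε :=
    le_iSup₂_of_le E (fun n _ => (hsep n).mono subset_rfl ((hsep n).1.trans (hXY n))) le_rfl
  refine (iInf₂_le E fun n _ => hspan n).trans (le_trans ?_ (mul_le_mul_right hR _))
  rw [← ENNReal.tsum_mul_left]
  refine le_trans (ENNReal.tsum_le_tsum fun n => ?_) (ENNReal.tsum_mono_subtype
    (fun n => ENNReal.ofReal (Real.exp (β * T + |β| * M)) * ∑ x ∈ E n, nlWeight f F Φ n x *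
      ENNReal.ofReal (Real.exp (birkhoff f (fun x => -β * ψ x) n x))) hST)
  rw [Finset.mul_sum]
  refine Finset.sum_le_sum fun x hx => ?_
  rw [mul_left_comm, ← ENNReal.ofReal_mul (Real.exp_nonneg _), ← Real.exp_add]
  refine le_mul_of_one_le_right' ?_
  rw [ENNReal.one_le_ofReal, Real.one_le_exp_iff, birkhoff_const_mul]
  have h := abs_birkhoff_sub_le_of_mem_inducedXn hM ((hsep n).1 hx)
  have h1 : β * (birkhoff f ψ n x - T) ≤ |β| * M := (le_abs_self _).trans <| by
    rw [abs_mul]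
    exact mul_le_mul_of_nonneg_left h (abs_nonneg β)
  linarith

lemma tsum_sum_nlWeight_le_mul_nlInducedQ {d : ℕ} {f : X → X} {ψ : X → ℝ} {m : ℝ}
    (hm : ∀ x, m ≤ ψ x) {F : (Fin d → ℝ) → ℝ} {Φ : X → Fin d → ℝ} {δ ε T : ℝ} (hδ : 0 ≤ δ)
    (hW : ∀ (n : ℕ) (x y : X), (∀ i < n, dist (f^[i] x) (f^[i] y) ≤ ε / 2) →
      n * F (fun i => birkhoffVec f Φ n y i / n) ≤
        n * (δ * m) + n * F (fun i => birkhoffVec f Φ n x i / n))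
    {E : ℕ → Finset X} (hE : ∀ n, IsSeparatedSetOf f n ε (inducedXn f ψ T n) (E n)) :
    ∑' n : ℕ, ∑ x ∈ E n, nlWeight f F Φ n x ≤
      ENNReal.ofReal (Real.exp (δ * T)) * nlInducedQ f ψ F Φ T (ε / 2) := by
  have hpos : ENNReal.ofReal (Real.exp (δ * T)) ≠ 0 := by simp [Real.exp_pos]
  rw [← ENNReal.div_le_iff' hpos ENNReal.ofReal_ne_top]
  refine le_iInf₂ fun C hC => ?_
  rw [ENNReal.div_le_iff' hpos ENNReal.ofReal_ne_top, ← ENNReal.tsum_mul_left]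
  have hsupp : Function.support (fun n => ∑ x ∈ E n, nlWeight f F Φ n x) ⊆
      inducedST f ψ T := fun n hn => by
    obtain ⟨x, hx, -⟩ := Finset.exists_ne_zero_of_sum_ne_zero hn
    exact ⟨x, (hE n).1 hx⟩
  rw [← tsum_subtype_eq_of_support_subset hsupp]
  refine ENNReal.tsum_le_tsum fun ⟨n, hn⟩ => ?_
  obtain ⟨g, hg, hinj⟩ := (hE n).exists_injOn (hC n hn)
  rw [Finset.mul_sum]
  classical
  refine le_trans ?_ (Finset.sum_le_sum_of_subset
    (Finset.image_subset_iff.2 fun x hx => (hg x hx).1))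
  rw [Finset.sum_image hinj]
  refine Finset.sum_le_sum fun x hx => ?_
  rw [nlWeight, nlWeight, ← ENNReal.ofReal_mul (Real.exp_nonneg _), ← Real.exp_add]
  refine ENNReal.ofReal_le_ofReal (Real.exp_le_exp.2 ((hW n _ x (hg x hx).2).trans ?_))
  have h1 : n * m ≤ T := (mul_le_birkhoff f hm n x).trans ((hE n).1 hx).1
  nlinarith [mul_le_mul_of_nonneg_left h1 hδ]

/-- To bound `nlR` it suffices to consider families separated for all `n`. -/
lemma nlR_le {d : ℕ} {f : X → X} {ψ : X → ℝ} {F : (Fin d → ℝ) → ℝ} {Φ : X → Fin d → ℝ}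
    {φ : X → ℝ} {T ε : ℝ} {B : ℝ≥0∞}
    (h : ∀ E : ℕ → Finset X, (∀ n, IsSeparatedSetOf f n ε (inducedYn f ψ T n) (E n)) →
      ∑' n : ℕ, ∑ x ∈ E n,
        nlWeight f F Φ n x * ENNReal.ofReal (Real.exp (birkhoff f φ n x)) ≤ B) :
    nlR f ψ F Φ φ T ε ≤ B := by
  classical
  refine iSup₂_le fun E hE => le_trans ?_
    (h (fun n => if n ∈ inducedGT f ψ T then E n else ∅) fun n => ?_)
  · rw [tsum_subtype (inducedGT f ψ T) fun n => ∑ x ∈ E n,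
      nlWeight f F Φ n x * ENNReal.ofReal (Real.exp (birkhoff f φ n x))]
    refine ENNReal.tsum_le_tsum fun n => ?_
    by_cases hn : n ∈ inducedGT f ψ T <;> simp [hn]
  · by_cases hn : n ∈ inducedGT f ψ T
    · simpa [hn] using hE n hn
    · simp [hn, IsSeparatedSetOf]

lemma nlR_le_tsum {d : ℕ} {f : X → X} {ψ : X → ℝ} {m M : ℝ} (hm0 : 0 < m)
    (hm : ∀ x, m ≤ ψ x) (hM : ∀ x, ψ x ≤ M) {F : (Fin d → ℝ) → ℝ} {Φ : X → Fin d → ℝ}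
    {β δ ε T : ℝ} (hδ : 0 ≤ δ)
    (hW : ∀ (n : ℕ) (x y : X), (∀ i < n, dist (f^[i] x) (f^[i] y) ≤ ε / 2) →
      n * F (fun i => birkhoffVec f Φ n y i / n) ≤
        n * (δ * m) + n * F (fun i => birkhoffVec f Φ n x i / n)) :
    nlR f ψ F Φ (fun x => -β * ψ x) T ε ≤
      ∑' k : ℕ, ENNReal.ofReal (Real.exp (|β| * M + (δ - β) * (T + k * m))) *
        nlInducedQ f ψ F Φ (T + k * m) (ε / 2) := by
  classical
  refine nlR_le fun E hE => ?_
  let E' : ℕ → ℕ → Finset X := fun k n =>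
    (E n).filter fun x => x ∈ inducedXn f ψ (T + (k : ℝ) * m) n
  have hE' : ∀ k n : ℕ, IsSeparatedSetOf f n ε (inducedXn f ψ (T + k * m) n) (E' k n) :=
    fun k n => (hE n).mono (Finset.filter_subset _ _) fun x hx => (Finset.mem_filter.1 hx).2
  have hcover : ∀ n (w : X → ℝ≥0∞), ∑ x ∈ E n, w x ≤ ∑' k, ∑ x ∈ E' k n, w x := fun n w => by
    simp only [E', Finset.sum_filter]
    rw [Summable.tsum_finsetSum fun _ _ => ENNReal.summable]
    refine Finset.sum_le_sum fun x hx => ?_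
    obtain ⟨k, hk⟩ := exists_mem_inducedXn_add_mul hm0 hm ((hE n).1 hx)
    exact le_trans (by simp [hk]) (ENNReal.le_tsum k)
  refine (ENNReal.tsum_le_tsum fun n => hcover n _).trans ?_
  rw [ENNReal.tsum_comm]
  refine ENNReal.tsum_le_tsum fun k => ?_
  have hexp : ENNReal.ofReal (Real.exp (|β| * M + (δ - β) * (T + k * m))) =
      ENNReal.ofReal (Real.exp (|β| * M - β * (T + k * m))) *
        ENNReal.ofReal (Real.exp (δ * (T + k * m))) := by
    rw [← ENNReal.ofReal_mul (Real.exp_nonneg _), ← Real.exp_add]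
    ring_nf
  rw [hexp, mul_assoc]
  refine le_trans ?_ (mul_le_mul_right (tsum_sum_nlWeight_le_mul_nlInducedQ hm hδ hW (hE' k)) _)
  rw [← ENNReal.tsum_mul_left]
  refine ENNReal.tsum_le_tsum fun n => ?_
  rw [Finset.mul_sum]
  refine Finset.sum_le_sum fun x hx => ?_
  rw [mul_comm]
  refine mul_le_mul_left (ENNReal.ofReal_le_ofReal (Real.exp_le_exp.2 ?_)) _
  have h := abs_birkhoff_sub_le_of_mem_inducedXn hM ((hE' k n).1 hx)
  have h1 : -(β * (birkhoff f ψ n x - (T + k * m))) ≤ |β| * M := (neg_le_abs _).trans <| by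
    rw [abs_mul]
    exact mul_le_mul_of_nonneg_left h (abs_nonneg β)
  rw [birkhoff_const_mul]
  linarith

end Weights

section GrowthRates

lemma le_ofReal_exp_of_log_mul_inv_le {q : ℝ≥0∞} {γ T : ℝ} (hT : 0 < T)
    (h : ENNReal.log q * ((T⁻¹ : ℝ) : EReal) ≤ γ) : q ≤ ENNReal.ofReal (Real.exp (γ * T)) := by
  have h1 : ENNReal.log q ≤ ((γ * T : ℝ) : EReal) := by
    have h2 := mul_le_mul_of_nonneg_right h (EReal.coe_nonneg.2 hT.le)
    rwa [mul_assoc, ← EReal.coe_mul, inv_mul_cancel₀ hT.ne', EReal.coe_one, mul_one,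
      ← EReal.coe_mul] at h2
  rw [← EReal.exp_coe, ← ENNReal.exp_log q]
  exact EReal.exp_monotone h1

lemma limsup_log_mul_inv_le {q : ℝ → ℝ≥0∞} {β K : ℝ}
    (h : ∀ᶠ T in atTop, q T ≤ ENNReal.ofReal (Real.exp (β * T + K))) :
    limsup (fun T : ℝ => ENNReal.log (q T) * ((T⁻¹ : ℝ) : EReal)) atTop ≤ β := by
  have hlim : Tendsto (fun T : ℝ => ((β + K * T⁻¹ : ℝ) : EReal)) atTop (𝓝 (β : EReal)) := by
    refine (continuous_coe_real_ereal.tendsto β).comp ?_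
    simpa using (tendsto_inv_atTop_zero.const_mul K).const_add β
  rw [← hlim.limsup_eq]
  refine limsup_le_limsup ?_
  filter_upwards [h, eventually_gt_atTop 0] with T hq hT
  have h1 : ENNReal.log (q T) ≤ ((β * T + K : ℝ) : EReal) := by
    rw [← EReal.log_exp ((β * T + K : ℝ) : EReal), EReal.exp_coe]
    exact ENNReal.log_monotone hq
  refine (mul_le_mul_of_nonneg_right h1 (EReal.coe_nonneg.2 (inv_nonneg.2 hT.le))).trans ?_
  rw [← EReal.coe_mul]
  refine EReal.coe_le_coe_iff.2 (le_of_eq ?_)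
  field_simp

end GrowthRates

section Comparison
variable [MetricSpace X] [CompactSpace X] {d : ℕ} {f : X → X} {ψ : X → ℝ}
  {Φ : X → Fin d → ℝ} {F : (Fin d → ℝ) → ℝ} {β : ℝ}

lemma nlInducedPressure_le_of_limsup_nlR_lt_top (hf : Continuous f) (hψ : Continuous ψ)
    (hψpos : ∀ x, 0 < ψ x)
    (h : limsup (fun ε : ℝ => limsup (fun T : ℝ => nlR f ψ F Φ (fun x => -β * ψ x) T ε) atTop)
      (𝓝[>] (0 : ℝ)) < ⊤) :
    nlInducedPressure f ψ F Φ ≤ β := by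
  obtain ⟨m, M, -, -, hM⟩ := exists_pos_bounds hψ hψpos
  refine limsup_le_of_le (h := ?_)
  filter_upwards [eventually_lt_of_limsup_lt h, self_mem_nhdsWithin] with ε hε hε0
  obtain ⟨C, hC, -⟩ := ENNReal.lt_iff_exists_nnreal_btwn.1 hε
  have hR := (tendsto_atTop_add_const_right atTop (-M) tendsto_id).eventually
    (eventually_lt_of_limsup_lt hC)
  refine limsup_log_mul_inv_le (K := |β| * M + C) ?_
  filter_upwards [hR] with T hT
  refine (nlInducedQ_le_mul_nlR hf hM F Φ β T hε0).trans ?_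
  rw [← add_assoc, Real.exp_add (β * T + |β| * M), ENNReal.ofReal_mul (Real.exp_nonneg _)]
  refine mul_le_mul_right (hT.le.trans ?_) _
  rw [← ENNReal.ofReal_coe_nnreal]
  exact ENNReal.ofReal_le_ofReal (by linarith [Real.add_one_le_exp (C : ℝ)])

lemma limsup_nlR_lt_top_of_nlInducedPressure_lt (hψ : Continuous ψ) (hψpos : ∀ x, 0 < ψ x)
    (hΦ : Continuous Φ) (hF : Continuous F) (h : nlInducedPressure f ψ F Φ < β) :
    limsup (fun ε : ℝ => limsup (fun T : ℝ => nlR f ψ F Φ (fun x => -β * ψ x) T ε) atTop)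
      (𝓝[>] (0 : ℝ)) < ⊤ := by
  obtain ⟨m, M, hm0, hm, hM⟩ := exists_pos_bounds hψ hψpos
  obtain ⟨γ, hγ, hγβ⟩ := EReal.lt_iff_exists_real_btwn.1 h
  obtain ⟨c, hc, rfl⟩ : ∃ c > 0, β = γ + 2 * c :=
    ⟨(β - γ) / 2, half_pos (sub_pos.2 (EReal.coe_lt_coe_iff.1 hγβ)), by ring⟩
  have hhalf : Tendsto (fun ε : ℝ => ε / 2) (𝓝[>] 0) (𝓝[>] 0) := by
    refine tendsto_nhdsWithin_iff.2 ⟨?_, ?_⟩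
    · exact Tendsto.mono_left (by simpa using (continuous_id.div_const (2 : ℝ)).tendsto 0)
        nhdsWithin_le_nhds
    · filter_upwards [self_mem_nhdsWithin] with ε hε
      exact half_pos (mem_Ioi.1 hε)
  let r := ENNReal.ofReal (Real.exp (-(c * m)))
  have hr : r < 1 := by
    rw [ENNReal.ofReal_lt_one, Real.exp_lt_one_iff]
    linarith [mul_pos hc hm0]
  let B := ENNReal.ofReal (Real.exp (|γ + 2 * c| * M)) * (1 - r)⁻¹
  have hB : B < ⊤ := ENNReal.mul_lt_top ENNReal.ofReal_lt_top
    (ENNReal.inv_lt_top.2 (tsub_pos_of_lt hr))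
  refine lt_of_le_of_lt (limsup_le_of_le (h := ?_)) hB
  filter_upwards [hhalf.eventually (eventually_lt_of_limsup_lt hγ),
    hhalf.eventually (eventually_forall_mul_birkhoffVec_le f hΦ hF (mul_pos hc hm0))]
    with ε hQ hW
  obtain ⟨T₀, hT₀⟩ := eventually_atTop.1 (eventually_lt_of_limsup_lt hQ)
  refine limsup_le_of_le (h := ?_)
  filter_upwards [eventually_ge_atTop T₀, eventually_gt_atTop 0] with T hT hT0
  refine (nlR_le_tsum hm0 hm hM hc.le hW).trans ?_
  simp only [B]
  rw [← ENNReal.tsum_geometric, ← ENNReal.tsum_mul_left]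
  refine ENNReal.tsum_le_tsum fun k => ?_
  have hkm : 0 ≤ k * m := mul_nonneg k.cast_nonneg hm0.le
  refine (mul_le_mul_right (le_ofReal_exp_of_log_mul_inv_le (by linarith)
    (hT₀ (T + k * m) (by linarith)).le) _).trans ?_
  rw [← ENNReal.ofReal_pow (Real.exp_nonneg _), ← Real.exp_nat_mul,
    ← ENNReal.ofReal_mul (Real.exp_nonneg _), ← ENNReal.ofReal_mul (Real.exp_nonneg _),
    ← Real.exp_add, ← Real.exp_add]
  refine ENNReal.ofReal_le_ofReal (Real.exp_le_exp.2 ?_)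
  nlinarith [mul_pos hc hT0]

end Comparison

/-- The nonlinear induced pressure is the infimum of those `β ∈ ℝ`
for which `lim_{ε→0} limsup_{T→∞} R^F_{ψ,T}(Φ, −βψ, ε) < ∞` (with `inf ∅ = +∞`;
the limit as `ε → 0⁺` is realized as a `limsup` along `𝓝[>] 0`). -/
theorem nlInducedPressure_eq_sInf_R
    {X : Type*} [MetricSpace X] [CompactSpace X] {d : ℕ}
    (f : X → X) (hf : Continuous f)
    (ψ : X → ℝ) (hψ : Continuous ψ) (hψpos : ∀ x, 0 < ψ x)
    (Φ : X → Fin d → ℝ) (hΦ : Continuous Φ)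
    (F : (Fin d → ℝ) → ℝ) (hF : Continuous F) :
    nlInducedPressure f ψ F Φ =
      sInf {b : EReal | ∃ β : ℝ, b = (β : EReal) ∧
        limsup (fun ε : ℝ =>
            limsup (fun T : ℝ => nlR f ψ F Φ (fun x => -β * ψ x) T ε) atTop)
          (𝓝[>] (0 : ℝ)) < ⊤} := by
  refine le_antisymm (le_sInf ?_) (EReal.le_of_forall_lt_iff_le.1 fun β hβ => ?_)
  · rintro _ ⟨β, rfl, hβ⟩
    exact nlInducedPressure_le_of_limsup_nlR_lt_top hf hψ hψpos hβ
  · exact sInf_le ⟨β, rfl, limsup_nlR_lt_top_of_nlInducedPressure_lt hψ hψpos hΦ hF hβ⟩
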